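/- arXiv:1512.02090 — 3 statements merged into one kernel-verified Lean document; each statement's English description precedes it below -/
import Mathlib

section
/- Let Y : (Fin n → ZMod 2) → (complex d×d matrices) be a family such that each Y_a is an observable (Hermitian with Y_a² = 1). Then each Fourier coefficient Ŷ_u is Hermitian, each Ŷ_u² is positive semidefinite, and ∑_u Ŷ_u² = 1; in other words, the family (Ŷ_u²)_u is a POVM on ℂ^d. -/
open Matrix BigOperators
open scoped ComplexOrder Kronecker

noncomputable section

/-- An observable: a Hermitian matrix squaring to the identity. -/
def IsObservable {ι : Type*} [Fintype ι] [DecidableEq ι] (A : Matrix ι ι ℂ) : Prop :=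
  A.IsHermitian ∧ A * A = 1

/-- The character `χ : ZMod 2 → ℂ` with `χ(0) = 1`, `χ(1) = -1`. -/
def chi (x : ZMod 2) : ℂ := if x = 0 then 1 else -1

/-- The mod-2 dot product `a·b = ∑ i, a i * b i`. -/
def dotp {n : ℕ} (a b : Fin n → ZMod 2) : ZMod 2 := ∑ i, a i * b i

/-- The Fourier transform `Ŷ_u = 2^{-n} ∑_a χ(u·a) Y_a` of a matrix-valued family. -/
def fhat {ι : Type*} [Fintype ι] [DecidableEq ι] {n : ℕ}
    (Y : (Fin n → ZMod 2) → Matrix ι ι ℂ) (u : Fin n → ZMod 2) : Matrix ι ι ℂ :=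
  ((2 : ℂ) ^ n)⁻¹ • ∑ a, chi (dotp u a) • Y a

theorem chi_add_aux (x y : ZMod 2) : chi (x + y) = chi x * chi y := by
  have h01 : ∀ c : ZMod 2, c = 0 ∨ c = 1 := by decide
  have h11 : (1 : ZMod 2) + 1 = 0 := by decide
  rcases h01 x with rfl | rfl <;> rcases h01 y with rfl | rfl <;> simp [chi, h11]

theorem chi_sum_aux {n : ℕ} (f : Fin n → ZMod 2) : chi (∑ i, f i) = ∏ i, chi (f i) := by
  induction n with
  | zero => simp [chi]
  | succ k ih => rw [Fin.sum_univ_succ, Fin.prod_univ_succ, chi_add_aux, ih]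

theorem chi_orth_one (a b : ZMod 2) :
    ∑ x : ZMod 2, chi (x * a) * chi (x * b) = if a = b then 2 else 0 := by
  have h : ∀ f : ZMod 2 → ℂ, ∑ x, f x = f 0 + f 1 := fun f => Fin.sum_univ_two f
  have h01 : ∀ c : ZMod 2, c = 0 ∨ c = 1 := by decide
  rw [h]
  rcases h01 a with rfl | rfl <;> rcases h01 b with rfl | rfl <;> simp [chi] <;> norm_num

theorem chi_orth {n : ℕ} (a b : Fin n → ZMod 2) :
    ∑ u, chi (dotp u a) * chi (dotp u b) = if a = b then (2 : ℂ) ^ n else 0 := by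
  have h := Finset.prod_univ_sum (fun _ : Fin n => (Finset.univ : Finset (ZMod 2)))
    (fun i x => chi (x * a i) * chi (x * b i))
  rw [Fintype.piFinset_univ] at h
  simp only [dotp, chi_sum_aux, ← Finset.prod_mul_distrib]
  rw [← h]
  simp only [chi_orth_one]
  split_ifs with hab
  · subst hab; simp
  · obtain ⟨i, hi⟩ := Function.ne_iff.mp hab
    exact Finset.prod_eq_zero (Finset.mem_univ i) (by simp [hi])

theorem fhat_herm {d n : ℕ} (Y : (Fin n → ZMod 2) → Matrix (Fin d) (Fin d) ℂ)
    (hY : ∀ a, IsObservable (Y a)) (u : Fin n → ZMod 2) : (fhat Y u).IsHermitian := by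
  have hc : ∀ x, star (chi x) = chi x := by
    intro x; unfold chi; split_ifs <;> simp
  unfold fhat Matrix.IsHermitian
  rw [conjTranspose_smul, conjTranspose_sum]
  congr 1
  · simp
  · refine Finset.sum_congr rfl fun a _ => ?_
    rw [conjTranspose_smul, hc, (hY a).1.eq]

theorem fhat_sum {d n : ℕ} (Y : (Fin n → ZMod 2) → Matrix (Fin d) (Fin d) ℂ)
    (hY : ∀ a, IsObservable (Y a)) : ∑ u, (fhat Y u) ^ 2 = 1 := by
  have h2 : ((2 : ℂ) ^ n) ≠ 0 := by positivity
  have key : ∑ u, (∑ a, chi (dotp u a) • Y a) * (∑ a, chi (dotp u a) • Y a)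
      = ((2 : ℂ) ^ n * 2 ^ n) • (1 : Matrix (Fin d) (Fin d) ℂ) := by
    simp only [Finset.sum_mul_sum, smul_mul_smul_comm]
    rw [Finset.sum_comm]
    have : ∀ a, ∑ u, ∑ b, (chi (dotp u a) * chi (dotp u b)) • (Y a * Y b)
        = (2 : ℂ) ^ n • (1 : Matrix (Fin d) (Fin d) ℂ) := by
      intro a
      rw [Finset.sum_comm]
      simp only [← Finset.sum_smul, chi_orth]
      simp [ite_smul, (hY a).2]
    simp only [this]
    simp [Finset.sum_const, ZMod.card, mul_smul, ← Nat.cast_smul_eq_nsmul ℂ]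
  simp only [fhat, pow_two, smul_mul_smul_comm]
  rw [← Finset.smul_sum, key, smul_smul]
  field_simp
  simp

/-- For a family of observables `Y`, each Fourier coefficient `Ŷ_u` is Hermitian, each
`Ŷ_u²` is positive semidefinite, and `∑_u Ŷ_u² = 1`: the family `(Ŷ_u²)_u` is a POVM. -/
theorem fhat_sq_isPOVM {d n : ℕ} (Y : (Fin n → ZMod 2) → Matrix (Fin d) (Fin d) ℂ)
    (hY : ∀ a, IsObservable (Y a)) :
    (∀ u, (fhat Y u).IsHermitian) ∧ (∀ u, ((fhat Y u) ^ 2).PosSemidef) ∧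
      ∑ u, (fhat Y u) ^ 2 = 1 := by
  refine ⟨fhat_herm Y hY, fun u => ?_, fhat_sum Y hY⟩
  have h := Matrix.posSemidef_conjTranspose_mul_self (fhat Y u)
  rwa [(fhat_herm Y hY u).eq, ← pow_two] at h
end
end

section
/- Let A, B, C, D be observables on ℂ^d such that C and D each commute with both A and B. Then the following operator identity holds: ((A+B)/√2 − C)² + ((A−B)/√2 − D)² = 4·1 − √2·(A·C + B·C + A·D − B·D). -/
open Matrix BigOperators
open scoped ComplexOrder Kronecker

noncomputable section

/-- The CHSH sum-of-squares identity: for observables `A, B, C, D` with `C, D` commuting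
with `A` and `B`,
`((A+B)/√2 − C)² + ((A−B)/√2 − D)² = 4·1 − √2·(AC + BC + AD − BD)`. -/
theorem chsh_sos_identity {d : ℕ} (A B C D : Matrix (Fin d) (Fin d) ℂ)
    (hA : IsObservable A) (hB : IsObservable B)
    (hC : IsObservable C) (hD : IsObservable D)
    (hCA : C * A = A * C) (hCB : C * B = B * C)
    (hDA : D * A = A * D) (hDB : D * B = B * D) :
    (((Real.sqrt 2 : ℂ))⁻¹ • (A + B) - C) ^ 2 + (((Real.sqrt 2 : ℂ))⁻¹ • (A - B) - D) ^ 2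
      = (4 : ℂ) • (1 : Matrix (Fin d) (Fin d) ℂ)
          - (Real.sqrt 2 : ℂ) • (A * C + B * C + A * D - B * D) := by
  have h2 : (Real.sqrt 2 : ℂ) * (Real.sqrt 2 : ℂ) = 2 := by
    rw [← Complex.ofReal_mul, Real.mul_self_sqrt (by norm_num)]
    norm_num
  have h0 : (Real.sqrt 2 : ℂ) ≠ 0 := by
    intro h
    rw [h] at h2
    norm_num at h2
  obtain ⟨s, hs⟩ : ∃ s : ℂ, s = (Real.sqrt 2 : ℂ)⁻¹ := ⟨_, rfl⟩
  have hr : (Real.sqrt 2 : ℂ) = 2 * s := by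
    rw [hs, ← h2, mul_assoc, mul_inv_cancel₀ h0, mul_one]
  have hss : s * s = 1 / 2 := by
    rw [hs, ← mul_inv, h2]
    norm_num
  rw [← hs, hr]
  have e : (s • (A + B) - C) ^ 2 + (s • (A - B) - D) ^ 2
      = (s * s) • ((2 : ℂ) • (A * A) + (2 : ℂ) • (B * B)) + C * C + D * D
        - s • (A * C + C * A + B * C + C * B + A * D + D * A - B * D - D * B) := by
    simp only [pow_two, mul_add, add_mul, mul_sub, sub_mul, smul_mul_assoc, mul_smul_comm,
      smul_add, smul_sub]
    module
  rw [e, hss, hA.2, hB.2, hC.2, hD.2, hCA, hCB, hDA, hDB]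
  module
end
end

section
/- Let A, B, C, D be observables on ℂ^d such that C and D each commute with both A and B, let ψ ∈ ℂ^d be a unit vector, and let ε₁, ε₂ ≥ 0 satisfy ‖((A+B)/√2 − C) ψ‖ ≤ ε₁ and ‖((A−B)/√2 − D) ψ‖ ≤ ε₂. Then ‖(C·D + D·C) ψ‖ ≤ (1 + √2)·(ε₁ + ε₂); that is, C and D approximately anticommute on ψ. -/
open Matrix BigOperators
open scoped ComplexOrder Kronecker

noncomputable section

/-- Apply a matrix to a vector of the Euclidean space `ℂ^ι`. -/
def mApp {ι : Type*} [Fintype ι] [DecidableEq ι] (M : Matrix ι ι ℂ)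
    (ψ : EuclideanSpace ℂ ι) : EuclideanSpace ℂ ι :=
  Matrix.toEuclideanLin M ψ

theorem mApp_mul' {d : ℕ} (M N : Matrix (Fin d) (Fin d) ℂ) (v : EuclideanSpace ℂ (Fin d)) :
    mApp (M * N) v = mApp M (mApp N v) := by
  simp [mApp, Matrix.toLpLin_apply, Matrix.mulVec_mulVec]

theorem mApp_add' {d : ℕ} (M N : Matrix (Fin d) (Fin d) ℂ) (v : EuclideanSpace ℂ (Fin d)) :
    mApp (M + N) v = mApp M v + mApp N v := by
  simp [mApp]

theorem mApp_neg' {d : ℕ} (M : Matrix (Fin d) (Fin d) ℂ) (v : EuclideanSpace ℂ (Fin d)) :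
    mApp (-M) v = -mApp M v := by
  simp [mApp]

theorem mApp_smul' {d : ℕ} (c : ℂ) (M : Matrix (Fin d) (Fin d) ℂ)
    (v : EuclideanSpace ℂ (Fin d)) : mApp (c • M) v = c • mApp M v := by
  simp [mApp]

theorem mApp_norm {d : ℕ} (M : Matrix (Fin d) (Fin d) ℂ) (hM : IsObservable M)
    (v : EuclideanSpace ℂ (Fin d)) : ‖mApp M v‖ = ‖v‖ := by
  have h : inner ℂ (mApp M v) (mApp M v) = inner ℂ v v := by
    have hs := (Matrix.isSymmetric_toEuclideanLin_iff.mpr hM.1) v (mApp M v)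
    have h2 : mApp M (mApp M v) = v := by
      rw [← mApp_mul', hM.2]; simp [mApp]
    change inner ℂ (mApp M v) (mApp M v) = inner ℂ v (mApp M (mApp M v)) at hs
    rw [hs, h2]
  rw [inner_self_eq_norm_sq_to_K, inner_self_eq_norm_sq_to_K] at h
  have h' : ‖mApp M v‖ ^ 2 = ‖v‖ ^ 2 := by exact_mod_cast h
  exact (pow_left_inj₀ (norm_nonneg _) (norm_nonneg _) two_ne_zero).1 h'

theorem mApp_bound {d : ℕ} (M N : Matrix (Fin d) (Fin d) ℂ) (hM : IsObservable M)
    (hN : IsObservable N) (v : EuclideanSpace ℂ (Fin d)) :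
    ‖mApp (((Real.sqrt 2 : ℂ))⁻¹ • (M + N)) v‖ ≤ Real.sqrt 2 * ‖v‖ := by
  rw [mApp_smul', mApp_add', norm_smul]
  have h := norm_add_le (mApp M v) (mApp N v)
  rw [mApp_norm M hM, mApp_norm N hN] at h
  have h2 : ‖((Real.sqrt 2 : ℂ))⁻¹‖ = (Real.sqrt 2)⁻¹ := by
    rw [norm_inv, Complex.norm_real, Real.norm_of_nonneg (Real.sqrt_nonneg 2)]
  rw [h2]
  have hp : 0 < Real.sqrt 2 := by positivity
  have hs : Real.sqrt 2 * Real.sqrt 2 = 2 := Real.mul_self_sqrt (by norm_num)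
  rw [inv_mul_le_iff₀ hp, ← mul_assoc, hs]
  linarith

theorem IsObservable.neg' {d : ℕ} {M : Matrix (Fin d) (Fin d) ℂ} (hM : IsObservable M) :
    IsObservable (-M) :=
  ⟨hM.1.neg, by rw [neg_mul_neg, hM.2]⟩

/-- If `(A+B)/√2` is `ε₁`-close to `C` and `(A−B)/√2` is `ε₂`-close to `D` on `ψ`, then
`C` and `D` approximately anticommute on `ψ`:
`‖(CD + DC)ψ‖ ≤ (1 + √2)(ε₁ + ε₂)`. -/
theorem approx_anticommute {d : ℕ} (A B C D : Matrix (Fin d) (Fin d) ℂ)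
    (hA : IsObservable A) (hB : IsObservable B)
    (hC : IsObservable C) (hD : IsObservable D)
    (hCA : C * A = A * C) (hCB : C * B = B * C)
    (hDA : D * A = A * D) (hDB : D * B = B * D)
    (ψ : EuclideanSpace ℂ (Fin d)) (hψ : ‖ψ‖ = 1)
    (ε₁ ε₂ : ℝ) (hε₁ : 0 ≤ ε₁) (hε₂ : 0 ≤ ε₂)
    (h₁ : ‖mApp (((Real.sqrt 2 : ℂ))⁻¹ • (A + B) - C) ψ‖ ≤ ε₁)
    (h₂ : ‖mApp (((Real.sqrt 2 : ℂ))⁻¹ • (A - B) - D) ψ‖ ≤ ε₂) :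
    ‖mApp (C * D + D * C) ψ‖ ≤ (1 + Real.sqrt 2) * (ε₁ + ε₂) := by
  have bX := mApp_bound A B hA hB
  have bY := mApp_bound A (-B) hA hB.neg'
  rw [← sub_eq_add_neg] at bY
  have cX : D * (((Real.sqrt 2 : ℂ))⁻¹ • (A + B)) = (((Real.sqrt 2 : ℂ))⁻¹ • (A + B)) * D := by
    rw [mul_smul_comm, smul_mul_assoc, mul_add, add_mul, hDA, hDB]
  have cY : C * (((Real.sqrt 2 : ℂ))⁻¹ • (A - B)) = (((Real.sqrt 2 : ℂ))⁻¹ • (A - B)) * C := by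
    rw [mul_smul_comm, smul_mul_assoc, mul_sub, sub_mul, hCA, hCB]
  have hXY : (((Real.sqrt 2 : ℂ))⁻¹ • (A + B)) * (((Real.sqrt 2 : ℂ))⁻¹ • (A - B))
      + (((Real.sqrt 2 : ℂ))⁻¹ • (A - B)) * (((Real.sqrt 2 : ℂ))⁻¹ • (A + B)) = 0 := by
    simp only [mul_smul_comm, smul_mul_assoc, ← smul_add]
    have : (A + B) * (A - B) + (A - B) * (A + B) = 0 := by
      have e : (A + B) * (A - B) + (A - B) * (A + B) = 2 * (A * A) - 2 * (B * B) := by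
        noncomm_ring
      rw [e, hA.2, hB.2, sub_self]
    rw [this, smul_zero, smul_zero]
  generalize ((Real.sqrt 2 : ℂ))⁻¹ • (A + B) = X at *
  generalize ((Real.sqrt 2 : ℂ))⁻¹ • (A - B) = Y at *
  have key : C * D + D * C
      = -((C * (Y - D) + Y * (X - C)) + (D * (X - C) + X * (Y - D))) := by
    have e : -((C * (Y - D) + Y * (X - C)) + (D * (X - C) + X * (Y - D)))
        = C * D + D * C - (X * Y + Y * X) - (C * Y - Y * C) - (D * X - X * D) := by
      noncomm_ring
    rw [e, hXY, cX, cY]; simp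
  rw [key, mApp_neg', norm_neg, mApp_add', mApp_add', mApp_add', mApp_mul', mApp_mul',
    mApp_mul', mApp_mul']
  have t := norm_add_le (mApp C (mApp (Y - D) ψ) + mApp Y (mApp (X - C) ψ))
    (mApp D (mApp (X - C) ψ) + mApp X (mApp (Y - D) ψ))
  have t1 := norm_add_le (mApp C (mApp (Y - D) ψ)) (mApp Y (mApp (X - C) ψ))
  have t2 := norm_add_le (mApp D (mApp (X - C) ψ)) (mApp X (mApp (Y - D) ψ))
  rw [mApp_norm C hC] at t1
  rw [mApp_norm D hD] at t2
  have b1 := bY (mApp (X - C) ψ)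
  have b2 := bX (mApp (Y - D) ψ)
  have m1 := mul_le_mul_of_nonneg_left h₁ (Real.sqrt_nonneg 2)
  have m2 := mul_le_mul_of_nonneg_left h₂ (Real.sqrt_nonneg 2)
  linarith
end
end
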